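/- Every gauge-reversing map φ: C → C from a proper open convex cone to itself is a bijection. -/

import Mathlib

open Set Filter

/-- The gauge of a cone: `M_C(x,y) = inf {λ > 0 | λ • y - x ∈ closure C}`. -/
noncomputable def coneGauge {V : Type*} [NormedAddCommGroup V] [NormedSpace ℝ V]
    (C : Set V) (x y : V) : ℝ :=
  sInf {l : ℝ | 0 < l ∧ l • y - x ∈ closure C}

/-- A proper open convex cone. -/
def IsProperCone {V : Type*} [NormedAddCommGroup V] [NormedSpace ℝ V] (C : Set V) : Prop :=
  C.Nonempty ∧ IsOpen C ∧ Convex ℝ C ∧ (∀ x ∈ C, ∀ l : ℝ, 0 < l → l • x ∈ C) ∧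
    closure C ∩ (-(closure C)) ⊆ {0}

open Topology

namespace GR

variable {V : Type*} [NormedAddCommGroup V] [NormedSpace ℝ V]

section basic
variable {C : Set V}

lemma smulC (hC : IsProperCone C) {x : V} (hx : x ∈ C) {l : ℝ} (hl : 0 < l) : l • x ∈ C :=
  hC.2.2.2.1 x hx l hl

lemma isOpenC (hC : IsProperCone C) : IsOpen C := hC.2.1

lemma zeroK (hC : IsProperCone C) : (0 : V) ∈ closure C := by
  obtain ⟨x, hx⟩ := hC.1
  have h : Tendsto (fun t : ℝ => t • x) (𝓝[>] 0) (𝓝 ((0 : ℝ) • x)) :=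
    ((continuous_id.smul continuous_const).tendsto (0 : ℝ)).mono_left nhdsWithin_le_nhds
  rw [zero_smul] at h
  refine mem_closure_of_tendsto h ?_
  filter_upwards [self_mem_nhdsWithin] with t ht
  exact smulC hC hx ht

lemma smulK (hC : IsProperCone C) {x : V} (hx : x ∈ closure C) {l : ℝ} (hl : 0 ≤ l) :
    l • x ∈ closure C := by
  rcases hl.eq_or_lt with rfl | hl
  · rw [zero_smul]; exact zeroK hC
  · exact map_mem_closure (continuous_const_smul l) hx (fun y hy => smulC hC hy hl)

lemma addC (hC : IsProperCone C) {x y : V} (hx : x ∈ C) (hy : y ∈ C) : x + y ∈ C := by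
  have h := convex_iff_forall_pos.1 hC.2.2.1 hx hy (show (0 : ℝ) < 1 / 2 by norm_num)
    (show (0 : ℝ) < 1 / 2 by norm_num) (by norm_num)
  have h2 := smulC hC h (l := 2) (by norm_num)
  convert h2 using 1
  module

lemma addK (hC : IsProperCone C) {x y : V} (hx : x ∈ closure C) (hy : y ∈ closure C) :
    x + y ∈ closure C :=
  map_mem_closure₂ continuous_add hx hy (fun _ ha _ hb => addC hC ha hb)

open Pointwise in
lemma addCK (hC : IsProperCone C) {x y : V} (hx : x ∈ C) (hy : y ∈ closure C) : x + y ∈ C := by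
  have h : x + y ∈ C + closure C := Set.add_mem_add hx hy
  rw [(isOpenC hC).add_closure] at h
  obtain ⟨a, ha, b, hb, e⟩ := h
  rw [← e]; exact addC hC ha hb

lemma antisymmK (hC : IsProperCone C) {x : V} (hx : x ∈ closure C) (hx' : -x ∈ closure C) :
    x = 0 := by
  have := hC.2.2.2.2 ⟨hx, by simpa using hx'⟩
  simpa using this

lemma ball_lemma (hC : IsProperCone C) {x₀ : V} (hx₀ : x₀ ∈ C) :
    ∃ ε > 0, Metric.ball x₀ ε ⊆ C ∧ ∀ x ∈ Metric.ball x₀ ε, ∀ y ∈ Metric.ball x₀ ε,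
      (1 + ‖x - y‖ / ε) • y - x ∈ closure C := by
  obtain ⟨e, he, hb⟩ := Metric.isOpen_iff.1 (isOpenC hC) x₀ hx₀
  refine ⟨e / 2, by positivity, (Metric.ball_subset_ball (by linarith)).trans hb, ?_⟩
  intro x hx y hy
  rcases eq_or_ne x y with rfl | hxy
  · simpa using zeroK hC
  have hn : 0 < ‖x - y‖ := norm_pos_iff.2 (sub_ne_zero.2 hxy)
  set t := ‖x - y‖ / (e / 2) with ht
  have htp : 0 < t := by positivity
  have h1 : y + t⁻¹ • (y - x) ∈ C := by
    apply hb
    rw [Metric.mem_ball, dist_eq_norm]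
    rw [Metric.mem_ball, dist_eq_norm] at hy
    have : ‖t⁻¹ • (y - x)‖ = e / 2 := by
      rw [norm_smul, norm_sub_rev y x, Real.norm_of_nonneg (by positivity), ht]
      field_simp
    calc ‖y + t⁻¹ • (y - x) - x₀‖ = ‖(y - x₀) + t⁻¹ • (y - x)‖ := by congr 1; abel
      _ ≤ ‖y - x₀‖ + ‖t⁻¹ • (y - x)‖ := norm_add_le _ _
      _ < e := by linarith
  have h2 := subset_closure (smulC hC h1 htp)
  convert h2 using 1
  rw [smul_add, smul_smul, mul_inv_cancel₀ htp.ne', one_smul, add_smul, one_smul]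
  abel

lemma exists_dom (hC : IsProperCone C) {y : V} (hy : y ∈ C) (x : V) :
    ∃ l : ℝ, 0 < l ∧ l • y - x ∈ closure C := by
  have h : Tendsto (fun t : ℝ => y - t • x) (𝓝[>] 0) (𝓝 (y - (0 : ℝ) • x)) :=
    ((continuous_const.sub (continuous_id.smul continuous_const)).tendsto (0 : ℝ)).mono_left
      nhdsWithin_le_nhds
  rw [zero_smul, sub_zero] at h
  have h1 := h.eventually ((isOpenC hC).mem_nhds hy)
  obtain ⟨t, ht, ht0⟩ := (h1.and self_mem_nhdsWithin).exists
  have ht0 : 0 < t := ht0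
  refine ⟨t⁻¹, by positivity, ?_⟩
  have := subset_closure (smulC hC ht (inv_pos.2 ht0))
  rwa [smul_sub, smul_smul, inv_mul_cancel₀ ht0.ne', one_smul] at this

lemma limK {a b : V} (h : ∀ ε : ℝ, 0 < ε → a + ε • b ∈ closure C) : a ∈ closure C := by
  have h1 : Tendsto (fun t : ℝ => a + t • b) (𝓝[>] 0) (𝓝 (a + (0 : ℝ) • b)) :=
    ((continuous_const.add (continuous_id.smul continuous_const)).tendsto (0 : ℝ)).mono_left
      nhdsWithin_le_nhds
  rw [zero_smul, add_zero] at h1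
  refine isClosed_closure.mem_of_tendsto h1 ?_
  filter_upwards [self_mem_nhdsWithin] with t ht
  exact h t ht

lemma gauge_le_iff (hC : IsProperCone C) {x y : V} (hy : y ∈ C) {l : ℝ} (hl : 0 < l) :
    coneGauge C x y ≤ l ↔ l • y - x ∈ closure C := by
  constructor
  · intro h
    refine limK (b := y) fun ε hε => ?_
    obtain ⟨m, ⟨_, hm⟩, hml⟩ := exists_lt_of_csInf_lt (exists_dom hC hy x)
      (lt_of_le_of_lt h (lt_add_of_pos_right l hε))
    have := addK hC hm (smulK hC (subset_closure hy) (sub_nonneg.2 hml.le))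
    convert this using 1
    module
  · intro h
    exact csInf_le ⟨0, fun _ h => h.1.le⟩ ⟨hl, h⟩

lemma normal [FiniteDimensional ℝ V] (hC : IsProperCone C) (u : V) :
    ∃ N : ℝ, 0 < N ∧ ∀ (t : ℝ) (v : V), 0 ≤ t → t • u - v ∈ closure C → t • u + v ∈ closure C →
      ‖v‖ ≤ N * t := by
  by_contra! hcon
  choose t v ht h1 h2 h3 using fun n : ℕ => hcon (n + 1 : ℝ) (by positivity)
  have hv : ∀ n, 0 < ‖v n‖ := fun n =>
    lt_of_le_of_lt (mul_nonneg (by positivity) (ht n)) (h3 n)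
  have hw : ∀ n, ‖v n‖⁻¹ • v n ∈ Metric.sphere (0 : V) 1 := fun n => by
    rw [mem_sphere_zero_iff_norm, norm_smul, norm_inv, norm_norm, inv_mul_cancel₀ (hv n).ne']
  have : ProperSpace V := FiniteDimensional.proper ℝ V
  obtain ⟨w, hwS, g, hg, hlim⟩ := (isCompact_sphere (0 : V) 1).tendsto_subseq hw
  have hs : Tendsto (fun n => ‖v n‖⁻¹ * t n) atTop (𝓝 0) := by
    refine squeeze_zero (fun n => mul_nonneg (by positivity) (ht n)) (fun n => ?_)
      tendsto_one_div_add_atTop_nhds_zero_nat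
    rw [inv_mul_le_iff₀ (hv n), mul_one_div, le_div_iff₀ (by positivity), mul_comm]
    exact (h3 n).le
  have hs' := (hs.comp hg.tendsto_atTop).smul_const u
  rw [zero_smul] at hs'
  have hm := isClosed_closure.mem_of_tendsto (hs'.sub hlim) (s := closure C)
    (Eventually.of_forall fun n => by
      have := smulK hC (h1 (g n)) (inv_nonneg.2 (hv (g n)).le)
      rwa [smul_sub, smul_smul] at this)
  have hp := isClosed_closure.mem_of_tendsto (hs'.add hlim) (s := closure C)
    (Eventually.of_forall fun n => by
      have := smulK hC (h2 (g n)) (inv_nonneg.2 (hv (g n)).le)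
      rwa [smul_add, smul_smul] at this)
  rw [zero_add] at hp
  rw [zero_sub] at hm
  have := antisymmK hC hp hm
  rw [this] at hwS
  simp at hwS

end basic

/-- Gauge-preserving, phrased through the order. -/
def Pres (C : Set V) (f : V → V) : Prop :=
  MapsTo f C C ∧ ∀ x ∈ C, ∀ y ∈ C, ∀ l : ℝ, 0 < l →
    (l • y - x ∈ closure C ↔ l • f y - f x ∈ closure C)

variable {C : Set V} {f : V → V}

lemma Pres.iterate (hf : Pres C f) (n : ℕ) : Pres C (f^[n]) := by
  induction n with
  | zero => exact ⟨fun x hx => hx, fun x _ y _ l _ => Iff.rfl⟩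
  | succ n ih =>
    refine ⟨hf.1.iterate _, fun x hx y hy l hl => ?_⟩
    rw [Function.iterate_succ', Function.comp_apply, Function.comp_apply,
      ← hf.2 _ (ih.1 hx) _ (ih.1 hy) l hl]
    exact ih.2 x hx y hy l hl

lemma Pres.smul (hC : IsProperCone C) (hf : Pres C f) {x : V} (hx : x ∈ C) {l : ℝ} (hl : 0 < l) :
    f (l • x) = l • f x := by
  have hlx := smulC hC hx hl
  have h1 : l • f x - f (l • x) ∈ closure C :=
    (hf.2 _ hlx _ hx l hl).1 (by rw [sub_self]; exact zeroK hC)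
  have h2 : l⁻¹ • f (l • x) - f x ∈ closure C :=
    (hf.2 _ hx _ hlx l⁻¹ (inv_pos.2 hl)).1 (by
      rw [smul_smul, inv_mul_cancel₀ hl.ne', one_smul, sub_self]; exact zeroK hC)
  have h3 := smulK hC h2 hl.le
  rw [smul_sub, smul_smul, mul_inv_cancel₀ hl.ne', one_smul, ← neg_sub] at h3
  exact (sub_eq_zero.1 (antisymmK hC h1 h3)).symm

lemma Pres.locLip [FiniteDimensional ℝ V] (hC : IsProperCone C) (hf : Pres C f) {x₀ : V}
    (hx₀ : x₀ ∈ C) : ∃ ε > 0, Metric.ball x₀ ε ⊆ C ∧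
      ∃ L : NNReal, LipschitzOnWith L f (Metric.ball x₀ ε) := by
  obtain ⟨ε, hε, hsub, hb⟩ := ball_lemma hC hx₀
  obtain ⟨N, hN, hnorm⟩ := normal hC (f x₀)
  refine ⟨ε, hε, hsub, ⟨N * (2 / ε), by positivity⟩, ?_⟩
  have hx₀b : x₀ ∈ Metric.ball x₀ ε := Metric.mem_ball_self hε
  have key : ∀ x ∈ Metric.ball x₀ ε, ∀ y ∈ Metric.ball x₀ ε,
      (2 * (‖x - y‖ / ε)) • f x₀ - (f x - f y) ∈ closure C := by
    intro x hx y hy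
    have hy2 : (2 : ℝ) • f x₀ - f y ∈ closure C := by
      refine (hf.2 _ (hsub hy) _ hx₀ 2 (by norm_num)).1 ?_
      have h := hb y hy x₀ hx₀b
      have hd : ‖y - x₀‖ / ε ≤ 1 := by
        rw [div_le_one hε]; rw [Metric.mem_ball, dist_eq_norm] at hy; exact hy.le
      have := addK hC h (smulK hC (subset_closure hx₀) (sub_nonneg.2 hd))
      convert this using 1
      module
    have h1 := (hf.2 _ (hsub hx) _ (hsub hy) _ (by positivity)).1 (hb x hx y hy)
    have := addK hC h1 (smulK hC hy2 (l := ‖x - y‖ / ε) (by positivity))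
    convert this using 1
    module
  refine LipschitzOnWith.of_dist_le_mul fun x hx y hy => ?_
  rw [dist_eq_norm, dist_eq_norm]
  have := hnorm (2 * (‖x - y‖ / ε)) (f x - f y) (by positivity) (key x hx y hy) (by
    have := key y hy x hx
    rw [norm_sub_rev] at this
    convert this using 1
    abel)
  refine this.trans (le_of_eq ?_)
  change _ = N * (2 / ε) * ‖x - y‖
  ring

lemma Pres.continuousOn [FiniteDimensional ℝ V] (hC : IsProperCone C) (hf : Pres C f) :
    ContinuousOn f C := by
  intro x hx
  obtain ⟨ε, hε, hsub, L, hL⟩ := hf.locLip hC hx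
  exact (hL.continuousOn.continuousAt (Metric.ball_mem_nhds x hε)).continuousWithinAt

lemma Pres.exists_diff [FiniteDimensional ℝ V] (hC : IsProperCone C) (hf : Pres C f) :
    ∃ x ∈ C, DifferentiableAt ℝ f x := by
  obtain ⟨x₀, hx₀⟩ := hC.1
  obtain ⟨ε, hε, hsub, L, hL⟩ := hf.locLip hC hx₀
  let _ : MeasurableSpace V := borel V
  have : BorelSpace V := ⟨rfl⟩
  let μ : MeasureTheory.Measure V := MeasureTheory.Measure.addHaar
  have hae := hL.ae_differentiableWithinAt_of_mem (μ := μ)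
  have hpos : 0 < μ (Metric.ball x₀ ε) := Metric.measure_ball_pos μ x₀ hε
  obtain ⟨x, hx, hd⟩ : ∃ x, x ∈ Metric.ball x₀ ε ∧
      DifferentiableWithinAt ℝ f (Metric.ball x₀ ε) x := by
    by_contra! hcon
    have : μ (Metric.ball x₀ ε) = 0 := by
      refine MeasureTheory.measure_mono_null ?_ (MeasureTheory.ae_iff.1 hae)
      intro x hx h
      exact hcon x hx (h hx)
    exact hpos.ne' this
  exact ⟨x, hsub hx, hd.differentiableAt (Metric.isOpen_ball.mem_nhds hx)⟩

/-- A gauge-preserving map with a fixed point is onto. -/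
lemma Pres.surj_of_fixed [FiniteDimensional ℝ V] (hC : IsProperCone C) (hf : Pres C f) {x : V}
    (hx : x ∈ C) (hfx : f x = x) : SurjOn f C C := by
  intro y hy
  obtain ⟨r, hr, hr1⟩ := exists_dom hC hx y
  obtain ⟨s, hs, hs1⟩ := exists_dom hC hy x
  set I : Set V := {z | r • x - z ∈ closure C ∧ s • z - x ∈ closure C} with hI
  have hIC : I ⊆ C := by
    intro z hz
    have h1 := smulC hC (addCK hC hx hz.2) (inv_pos.2 hs)
    rwa [add_sub_cancel, smul_smul, inv_mul_cancel₀ hs.ne', one_smul] at h1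
  have : ProperSpace V := FiniteDimensional.proper ℝ V
  have hIcl : IsClosed I :=
    (isClosed_closure.preimage (by fun_prop : Continuous fun z : V => r • x - z)).inter
      (isClosed_closure.preimage (by fun_prop : Continuous fun z : V => s • z - x))
  have hIcpt : IsCompact I := by
    refine Metric.isCompact_of_isClosed_isBounded hIcl ?_
    obtain ⟨N, hN, hnorm⟩ := normal hC x
    refine (Metric.isBounded_closedBall (x := (0 : V)) (r := N * r)).subset fun z hz => ?_
    rw [mem_closedBall_zero_iff]
    exact hnorm r z hr.le hz.1
      (addK hC (smulK hC (subset_closure hx) hr.le) (subset_closure (hIC hz)))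
  have hmap : MapsTo f I I := by
    intro z hz
    have h1 := (hf.2 z (hIC hz) x hx r hr).1 hz.1
    have h2 := (hf.2 x hx z (hIC hz) s hs).1 hz.2
    rw [hfx] at h1 h2
    exact ⟨h1, h2⟩
  have hyI : y ∈ I := ⟨hr1, hs1⟩
  have horb : ∀ n, f^[n] y ∈ I := fun n => hmap.iterate n hyI
  have himg : IsClosed (f '' I) :=
    (hIcpt.image_of_continuousOn ((hf.continuousOn hC).mono hIC)).isClosed
  have hmem : y ∈ f '' I := by
    rw [← himg.closure_eq, Metric.mem_closure_iff]
    intro η hη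
    obtain ⟨N, hN, hnorm⟩ := normal hC y
    obtain ⟨z, hz, g, hg, hlim⟩ := hIcpt.tendsto_subseq horb
    obtain ⟨ε, hε, hsub, hb⟩ := ball_lemma hC (hIC hz)
    -- choose δ
    obtain ⟨δ, hδ, hδ1, hδη⟩ : ∃ δ : ℝ, 0 < δ ∧ δ ≤ 1 ∧ N * (2 * δ) < η := by
      refine ⟨min 1 (η / (4 * N)), by positivity, min_le_left _ _, ?_⟩
      have := min_le_right 1 (η / (4 * N))
      calc N * (2 * min 1 (η / (4 * N))) ≤ N * (2 * (η / (4 * N))) := by gcongr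
        _ = η / 2 := by field_simp; norm_num
        _ < η := by linarith
    have hev := hlim.eventually (Metric.ball_mem_nhds z (lt_min hε (half_pos (mul_pos hδ hε))))
    obtain ⟨n0, hn0⟩ := eventually_atTop.1 hev
    have ha := hn0 n0 le_rfl
    have hb' := hn0 (n0 + 1) (Nat.le_succ _)
    simp only [Function.comp_apply] at ha hb'
    have hlt : g n0 < g (n0 + 1) := hg (Nat.lt_succ_self _)
    obtain ⟨k, hk⟩ := Nat.exists_eq_add_of_lt hlt
    have hk' : g (n0 + 1) = g n0 + (k + 1) := by omega
    rw [hk', Function.iterate_add_apply] at hb'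
    set w := f^[k + 1] y with hw
    have hwC : w ∈ C := hIC (horb _)
    have hIt := hf.iterate (g n0)
    have close : ∀ p q : V, p ∈ Metric.ball z (min ε (δ * ε / 2)) →
        q ∈ Metric.ball z (min ε (δ * ε / 2)) → (1 + δ) • q - p ∈ closure C := by
      intro p q hp hq
      have hp1 := Metric.ball_subset_ball (min_le_left _ _) hp
      have hq1 := Metric.ball_subset_ball (min_le_left _ _) hq
      have hp2 := Metric.ball_subset_ball (min_le_right _ _) hp
      have hq2 := Metric.ball_subset_ball (min_le_right _ _) hq
      rw [Metric.mem_ball] at hp2 hq2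
      have hd : ‖p - q‖ / ε ≤ δ := by
        rw [div_le_iff₀ hε, ← dist_eq_norm]
        have := dist_triangle_right p q z
        linarith
      have := addK hC (hb p hp1 q hq1)
        (smulK hC (subset_closure (hsub hq1)) (sub_nonneg.2 hd))
      convert this using 1
      module
    have c1 : (1 + δ) • w - y ∈ closure C :=
      (hIt.2 y hy w hwC _ (by positivity)).2 (close _ _ ha hb')
    have c2 : (1 + δ) • y - w ∈ closure C :=
      (hIt.2 w hwC y hy _ (by positivity)).2 (close _ _ hb' ha)
    refine ⟨w, ⟨f^[k] y, horb k, (Function.iterate_succ_apply' f k y).symm⟩, ?_⟩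
    rw [dist_eq_norm]
    refine lt_of_le_of_lt (hnorm (2 * δ) (y - w) (by positivity) ?_ ?_) hδη
    · -- 2δ y - (y - w)
      have e1 := addK hC c1 (smulK hC c2 hδ.le)
      have e2 := addK hC e1 (smulK hC (subset_closure hy)
        (l := δ * (1 - δ)) (mul_nonneg hδ.le (by linarith)))
      convert e2 using 1
      module
    · have e2 := addK hC c2 (smulK hC (subset_closure hy) (l := δ) hδ.le)
      convert e2 using 1
      module
  obtain ⟨v, hv, e⟩ := hmem
  exact ⟨v, hIC hv, e⟩

lemma interiorK (hC : IsProperCone C) : interior (closure C) = C := by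
  have hne : (interior C).Nonempty := by rw [(isOpenC hC).interior_eq]; exact hC.1
  rw [hC.2.2.1.interior_closure_eq_interior_of_nonempty_interior hne, (isOpenC hC).interior_eq]

lemma Pres.surj [FiniteDimensional ℝ V] (hC : IsProperCone C) (hf : Pres C f) :
    SurjOn f C C := by
  obtain ⟨x, hx, hd⟩ := hf.exists_diff hC
  obtain ⟨A, hA⟩ := hd
  have hslope : ∀ v : V, Tendsto (fun t : ℝ => t⁻¹ • (f (x + t • v) - f x)) (𝓝[>] 0) (𝓝 (A v)) := by
    intro v
    have := (hA.hasLineDerivAt v).tendsto_slope_zero_right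
    simpa using this
  have hinC : ∀ v : V, ∀ᶠ t : ℝ in 𝓝[>] 0, x + t • v ∈ C := by
    intro v
    have h : Tendsto (fun t : ℝ => x + t • v) (𝓝[>] 0) (𝓝 (x + (0 : ℝ) • v)) :=
      ((continuous_const.add (continuous_id.smul continuous_const)).tendsto (0 : ℝ)).mono_left
        nhdsWithin_le_nhds
    rw [zero_smul, add_zero] at h
    exact h.eventually ((isOpenC hC).mem_nhds hx)
  have hAx : A x = f x := by
    refine tendsto_nhds_unique (hslope x) (tendsto_const_nhds.congr' ?_)
    filter_upwards [self_mem_nhdsWithin] with t ht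
    have ht : 0 < t := ht
    have : x + t • x = (1 + t) • x := by module
    rw [this, hf.smul hC hx (by positivity), add_smul, one_smul, add_sub_cancel_left, smul_smul,
      inv_mul_cancel₀ ht.ne', one_smul]
  have hmono : ∀ p ∈ C, ∀ q ∈ C, (q - p ∈ closure C ↔ f q - f p ∈ closure C) := by
    intro p hp q hq
    simpa using hf.2 p hp q hq 1 one_pos
  have hK1 : ∀ v ∈ closure C, A v ∈ closure C := by
    intro v hv
    refine isClosed_closure.mem_of_tendsto (hslope v) ?_
    filter_upwards [self_mem_nhdsWithin, hinC v] with t ht htC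
    have ht : 0 < t := ht
    refine smulK hC ((hmono _ hx _ htC).1 ?_) (inv_nonneg.2 ht.le)
    rw [add_sub_cancel_left]
    exact smulK hC hv ht.le
  have hK2 : ∀ v, A v ∈ closure C → v ∈ closure C := by
    intro v hv
    refine limK (b := x) fun ε hε => ?_
    have hAC : A (v + ε • x) ∈ C := by
      rw [map_add, map_smul, hAx, add_comm]
      exact addCK hC (smulC hC (hf.1 hx) hε) hv
    have hev := (hslope (v + ε • x)).eventually ((isOpenC hC).mem_nhds hAC)
    obtain ⟨t, ⟨h1, h2⟩, h3⟩ :=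
      ((hev.and (hinC (v + ε • x))).and self_mem_nhdsWithin).exists
    have ht : 0 < t := h3
    have h4 := smulK hC (subset_closure h1) ht.le
    rw [smul_smul, mul_inv_cancel₀ ht.ne', one_smul] at h4
    have h5 := (hmono _ hx _ h2).2 h4
    rw [add_sub_cancel_left] at h5
    have h6 := smulK hC h5 (inv_nonneg.2 ht.le)
    rwa [smul_smul, inv_mul_cancel₀ ht.ne', one_smul] at h6
  have hinj : Function.Injective (A : V →ₗ[ℝ] V) := by
    rw [injective_iff_map_eq_zero]
    intro v hv
    have hv : A v = 0 := hv
    refine antisymmK hC (hK2 v ?_) (hK2 (-v) ?_)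
    · rw [hv]; exact zeroK hC
    · rw [map_neg, hv, neg_zero]; exact zeroK hC
  let E : V ≃ₗ[ℝ] V := LinearEquiv.ofInjectiveEndo (A : V →ₗ[ℝ] V) hinj
  have hE : ∀ v, E v = A v := fun v => rfl
  have hsymK : ∀ v, E.symm v ∈ closure C ↔ v ∈ closure C := by
    intro v
    constructor
    · intro h
      have := hK1 _ h
      rwa [← hE, E.apply_symm_apply] at this
    · intro h
      apply hK2
      rwa [← hE, E.apply_symm_apply]
  have hsymC : ∀ v ∈ C, E.symm v ∈ C := by
    intro v hv
    have hop : IsOpen (A ⁻¹' C) := (isOpenC hC).preimage A.continuous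
    have hsub : A ⁻¹' C ⊆ C := by
      have : A ⁻¹' C ⊆ interior (closure C) :=
        interior_maximal (fun u hu => hK2 u (subset_closure hu)) hop
      rwa [interiorK hC] at this
    apply hsub
    rw [mem_preimage, ← hE, E.apply_symm_apply]
    exact hv
  have hP : Pres C (fun v => E.symm (f v)) := by
    refine ⟨fun v hv => hsymC _ (hf.1 hv), fun p hp q hq l hl => ?_⟩
    rw [hf.2 p hp q hq l hl, ← hsymK, map_sub, map_smul]
  have hfix : E.symm (f x) = x := by
    rw [LinearEquiv.symm_apply_eq, hE, hAx]
  intro y hy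
  obtain ⟨v, hv, e⟩ := hP.surj_of_fixed hC hx hfix (hsymC y hy)
  exact ⟨v, hv, E.symm.injective e⟩

end GR

/-- Every gauge-reversing self-map of a proper open convex cone is a bijection of the cone. -/
theorem gauge_reversing_bijective {V : Type*} [NormedAddCommGroup V] [NormedSpace ℝ V]
    [FiniteDimensional ℝ V] (C : Set V) (hC : IsProperCone C)
    (φ : V → V) (hmaps : Set.MapsTo φ C C)
    (hrev : ∀ x ∈ C, ∀ y ∈ C, coneGauge C (φ x) (φ y) = coneGauge C y x) :
    Set.BijOn φ C C := by
  have hP : GR.Pres C (φ ∘ φ) := by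
    refine ⟨hmaps.comp hmaps, fun x hx y hy l hl => ?_⟩
    have hx' := hmaps hx
    have hy' := hmaps hy
    rw [Function.comp_apply, Function.comp_apply, ← GR.gauge_le_iff hC hy hl,
      ← GR.gauge_le_iff hC (hmaps hy') hl, hrev _ hx' _ hy', hrev _ hy _ hx]
  refine ⟨hmaps, ?_, ?_⟩
  · have key : ∀ x ∈ C, ∀ y ∈ C, φ x = φ y → x - y ∈ closure C := by
      intro x hx y hy h
      have h1 : coneGauge C (φ x) (φ y) ≤ 1 := by
        rw [GR.gauge_le_iff hC (hmaps hy) one_pos, h, one_smul, sub_self]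
        exact GR.zeroK hC
      rw [hrev x hx y hy, GR.gauge_le_iff hC hx one_pos, one_smul] at h1
      exact h1
    intro x hx y hy h
    refine sub_eq_zero.1 (GR.antisymmK hC (key x hx y hy h) ?_)
    rw [neg_sub]
    exact key y hy x hx h.symm
  · intro y hy
    obtain ⟨v, hv, e⟩ := hP.surj hC hy
    exact ⟨φ v, hmaps hv, e⟩
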